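/- Let θ be an irrational real number and let m be a positive integer. If the total number of parts of p⁺_θ(m) and p⁻_θ(m), counted with multiplicity, is at most 3, then m·{θ} < 2 or m·(1 − {θ}) < 2. -/

import Mathlib

open Set

/-- The inclusion of an integer lattice point into the real plane. -/
def latticeToR (p : ℤ × ℤ) : ℝ × ℝ := ((p.1 : ℝ), (p.2 : ℝ))

/-- A polygonal path with vertices at integer lattice points, starting at `(0,0)`,
ending at `(m, e)`, with strictly increasing x-coordinates of the vertices, so that
the path is the graph of a piecewise linear function on `[0, m]`. -/
structure LatticePath (m : ℕ) (e : ℤ) where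
  n : ℕ
  v : Fin (n + 1) → ℤ × ℤ
  first : v 0 = (0, 0)
  last : v (Fin.last n) = ((m : ℤ), e)
  mono : ∀ i : Fin n, (v i.castSucc).1 < (v i.succ).1

namespace LatticePath

variable {m : ℕ} {e : ℤ}

/-- The trace of the path in the plane: the union of the closed segments joining
consecutive vertices. -/
def graph (P : LatticePath m e) : Set (ℝ × ℝ) :=
  ⋃ i : Fin P.n, segment ℝ (latticeToR (P.v i.castSucc)) (latticeToR (P.v i.succ))

/-- The slopes of consecutive edges are nonincreasing: the path is the graph of a
piecewise linear concave function. -/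
def IsConcave (P : LatticePath m e) : Prop :=
  ∀ i : ℕ, ∀ h : i + 2 ≤ P.n,
    ((P.v ⟨i + 2, by omega⟩).2 - (P.v ⟨i + 1, by omega⟩).2) *
        ((P.v ⟨i + 1, by omega⟩).1 - (P.v ⟨i, by omega⟩).1) ≤
      ((P.v ⟨i + 1, by omega⟩).2 - (P.v ⟨i, by omega⟩).2) *
        ((P.v ⟨i + 2, by omega⟩).1 - (P.v ⟨i + 1, by omega⟩).1)

/-- The slopes of consecutive edges are nondecreasing: the path is the graph of a
piecewise linear convex function. -/
def IsConvex (P : LatticePath m e) : Prop :=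
  ∀ i : ℕ, ∀ h : i + 2 ≤ P.n,
    ((P.v ⟨i + 1, by omega⟩).2 - (P.v ⟨i, by omega⟩).2) *
        ((P.v ⟨i + 2, by omega⟩).1 - (P.v ⟨i + 1, by omega⟩).1) ≤
      ((P.v ⟨i + 2, by omega⟩).2 - (P.v ⟨i + 1, by omega⟩).2) *
        ((P.v ⟨i + 1, by omega⟩).1 - (P.v ⟨i, by omega⟩).1)

end LatticePath

/-- `S` lies pointwise (in the vertical direction) below `T`. -/
def GraphLE (S T : Set (ℝ × ℝ)) : Prop :=
  ∀ x y y' : ℝ, (x, y) ∈ S → (x, y') ∈ T → y ≤ y'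

/-- An admissible path for the positive partition `p⁺_θ(m)`: a lattice path from
`(0,0)` to `(m, ⌊mθ⌋)` which is the graph of a piecewise linear concave function
and does not go above the line `y = θx`. -/
def PosPath (θ : ℝ) (m : ℕ) (P : LatticePath m ⌊(m : ℝ) * θ⌋) : Prop :=
  P.IsConcave ∧ ∀ p ∈ P.graph, p.2 ≤ θ * p.1

/-- An admissible path for the negative partition `p⁻_θ(m)`: a lattice path from
`(0,0)` to `(m, ⌈mθ⌉)` which is the graph of a piecewise linear convex function
and does not go below the line `y = θx`. -/
def NegPath (θ : ℝ) (m : ℕ) (P : LatticePath m ⌈(m : ℝ) * θ⌉) : Prop :=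
  P.IsConvex ∧ ∀ p ∈ P.graph, θ * p.1 ≤ p.2

/-- `P` is the pointwise maximal admissible path `Λ⁺_θ(m)`. -/
def IsMaxPosPath (θ : ℝ) (m : ℕ) (P : LatticePath m ⌊(m : ℝ) * θ⌋) : Prop :=
  PosPath θ m P ∧
    ∀ Q : LatticePath m ⌊(m : ℝ) * θ⌋, PosPath θ m Q → GraphLE Q.graph P.graph

/-- `P` is the pointwise minimal admissible path `Λ⁻_θ(m)`. -/
def IsMinNegPath (θ : ℝ) (m : ℕ) (P : LatticePath m ⌈(m : ℝ) * θ⌉) : Prop :=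
  NegPath θ m P ∧
    ∀ Q : LatticePath m ⌈(m : ℝ) * θ⌉, NegPath θ m Q → GraphLE P.graph Q.graph

/-- The x-coordinates of the integer lattice points lying on `S`. -/
def latticeXs (S : Set (ℝ × ℝ)) : Set ℤ :=
  {x : ℤ | ∃ y : ℤ, ((x : ℝ), (y : ℝ)) ∈ S}

open Classical in
/-- The multiset of consecutive gaps of a finite set of integers. -/
noncomputable def setGaps (X : Set ℤ) : Multiset ℤ :=
  if h : X.Finite then
    Multiset.ofList
      (List.zipWith (fun a b => b - a) (h.toFinset.sort (· ≤ ·))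
        (h.toFinset.sort (· ≤ ·)).tail)
  else 0

/-- The multiset of horizontal displacements between consecutive integer lattice
points lying on the path `P`: the partition `p⁺_θ(m)` (resp. `p⁻_θ(m)`) is
`pathPartition` of the maximal (resp. minimal) admissible path. -/
noncomputable def pathPartition {m : ℕ} {e : ℤ} (P : LatticePath m e) : Multiset ℤ :=
  setGaps (latticeXs P.graph)

/-- Membership in the segment joining two lattice points in different columns, as a cross
product condition. -/
theorem mem_segment_latticeToR {p q : ℤ × ℤ} (h : p.1 < q.1) (x y : ℝ) :
    (x, y) ∈ segment ℝ (latticeToR p) (latticeToR q) ↔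
      (p.1 : ℝ) ≤ x ∧ x ≤ q.1 ∧
        (y - p.2) * ((q.1 : ℝ) - p.1) = ((q.2 : ℝ) - p.2) * (x - p.1) := by
  have h' : (0 : ℝ) < (q.1 : ℝ) - p.1 := sub_pos.2 (by exact_mod_cast h)
  constructor
  · rintro ⟨a, b, ha, hb, hab, hxy⟩
    simp only [latticeToR, Prod.smul_mk, Prod.mk_add_mk, Prod.mk.injEq, smul_eq_mul] at hxy
    obtain ⟨rfl, rfl⟩ := hxy
    obtain rfl : a = 1 - b := by linarith
    refine ⟨?_, ?_, by ring⟩ <;> nlinarith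
  · rintro ⟨h1, h2, h3⟩
    refine ⟨(q.1 - x) / ((q.1 : ℝ) - p.1), (x - p.1) / ((q.1 : ℝ) - p.1),
      div_nonneg (by linarith) h'.le, div_nonneg (by linarith) h'.le, ?_, ?_⟩
    · rw [← add_div, div_eq_one_iff_eq h'.ne']
      ring
    · simp only [latticeToR, Prod.smul_mk, Prod.mk_add_mk, Prod.mk.injEq, smul_eq_mul]
      constructor
      · field_simp
        ring
      · field_simp
        linarith

namespace LatticePath

variable {m : ℕ} {e : ℤ}

theorem mem_graph_iff (P : LatticePath m e) (x y : ℝ) :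
    (x, y) ∈ P.graph ↔ ∃ i : Fin P.n,
      ((P.v i.castSucc).1 : ℝ) ≤ x ∧ x ≤ (P.v i.succ).1 ∧
        (y - (P.v i.castSucc).2) * (((P.v i.succ).1 : ℝ) - (P.v i.castSucc).1) =
          (((P.v i.succ).2 : ℝ) - (P.v i.castSucc).2) * (x - (P.v i.castSucc).1) := by
  simp only [graph, mem_iUnion, mem_segment_latticeToR (P.mono _)]

theorem strictMono_fst (P : LatticePath m e) : StrictMono fun i => (P.v i).1 :=
  Fin.strictMono_iff_lt_succ.2 P.mono

theorem fst_nonneg (P : LatticePath m e) (i) : 0 ≤ (P.v i).1 := by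
  have := P.strictMono_fst.monotone (Fin.zero_le i)
  simpa [P.first] using this

theorem fst_le (P : LatticePath m e) (i) : (P.v i).1 ≤ m := by
  have := P.strictMono_fst.monotone (Fin.le_last i)
  simpa [P.last] using this

theorem n_pos (P : LatticePath m e) (hm : 0 < m) : 0 < P.n := by
  by_contra! h
  obtain ⟨n, v, first, last, mono⟩ := P
  obtain rfl : n = 0 := by simpa using h
  have : (0, 0) = ((m : ℤ), e) := first.symm.trans last
  simp only [Prod.mk.injEq] at this
  omega

theorem vertex_mem_graph (P : LatticePath m e) (hm : 0 < m) (i) :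
    latticeToR (P.v i) ∈ P.graph := by
  simp only [graph, mem_iUnion]
  induction i using Fin.lastCases with
  | last =>
    obtain ⟨k, hk⟩ := Nat.exists_eq_succ_of_ne_zero (P.n_pos hm).ne'
    refine ⟨⟨k, by omega⟩, ?_⟩
    convert right_mem_segment ℝ _ _ using 3
    ext
    simp [hk]
  | cast i => exact ⟨i, left_mem_segment ℝ _ _⟩

theorem fst_mem_latticeXs (P : LatticePath m e) (hm : 0 < m) (i) :
    (P.v i).1 ∈ latticeXs P.graph :=
  ⟨(P.v i).2, P.vertex_mem_graph hm i⟩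

theorem zero_mem_latticeXs (P : LatticePath m e) (hm : 0 < m) : 0 ∈ latticeXs P.graph := by
  simpa [P.first] using P.fst_mem_latticeXs hm 0

theorem end_mem_latticeXs (P : LatticePath m e) (hm : 0 < m) :
    (m : ℤ) ∈ latticeXs P.graph := by
  simpa [P.last] using P.fst_mem_latticeXs hm (Fin.last _)

theorem finite_latticeXs (P : LatticePath m e) : (latticeXs P.graph).Finite := by
  refine (finite_Icc 0 (m : ℤ)).subset ?_
  rintro x ⟨y, hy⟩
  obtain ⟨i, h1, h2, -⟩ := (P.mem_graph_iff _ _).1 hy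
  norm_cast at h1 h2
  exact ⟨(P.fst_nonneg _).trans h1, h2.trans (P.fst_le _)⟩

theorem card_le_card_pathPartition_add_one (P : LatticePath m e) (S : Finset ℤ)
    (hS : ∀ x ∈ S, x ∈ latticeXs P.graph) :
    S.card ≤ Multiset.card (pathPartition P) + 1 := by
  classical
  have hsub : S ⊆ P.finite_latticeXs.toFinset := fun x hx => by simpa using hS x hx
  have := Finset.card_le_card hsub
  rw [pathPartition, setGaps, dif_pos P.finite_latticeXs]
  simp only [Multiset.coe_card, List.length_zipWith, List.length_tail, Finset.length_sort]
  omega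

theorem n_le_card_pathPartition (P : LatticePath m e) (hm : 0 < m) :
    P.n ≤ Multiset.card (pathPartition P) := by
  have := P.card_le_card_pathPartition_add_one
    (Finset.univ.image fun i => (P.v i).1) (by
      intro x hx
      obtain ⟨i, -, rfl⟩ := Finset.mem_image.1 hx
      exact P.fst_mem_latticeXs hm i)
  rw [Finset.card_image_of_injective _ P.strictMono_fst.injective, Finset.card_fin] at this
  omega

/-- The reflection of a path in the horizontal axis. -/
def reflect (P : LatticePath m e) : LatticePath m (-e) where
  n := P.n
  v i := ((P.v i).1, -(P.v i).2)
  first := by simp [P.first]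
  last := by simp [P.last]
  mono := P.mono

theorem mem_graph_reflect (P : LatticePath m e) (x y : ℝ) :
    (x, y) ∈ P.reflect.graph ↔ (x, -y) ∈ P.graph := by
  simp only [mem_graph_iff]
  refine exists_congr fun i => and_congr_right fun _ => and_congr_right fun _ => ?_
  simp only [reflect, Int.cast_neg]
  constructor <;> intro h <;> linarith

theorem pathPartition_reflect (P : LatticePath m e) :
    pathPartition P.reflect = pathPartition P := by
  have : latticeXs P.reflect.graph = latticeXs P.graph := by
    ext x
    simp only [latticeXs, mem_ofPred_eq, mem_graph_reflect]
    constructor <;> rintro ⟨y, hy⟩ <;> exact ⟨-y, by simpa using hy⟩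
  rw [pathPartition, pathPartition, this]

/-- The path through `(0,0)`, `(x,y)` and `(m,e)`. -/
def through (x y : ℤ) (h0 : 0 < x) (h1 : x < m) : LatticePath m e where
  n := 2
  v := ![(0, 0), (x, y), (m, e)]
  first := rfl
  last := rfl
  mono i := by fin_cases i <;> simpa

theorem mem_graph_through (x y : ℤ) (h0 : 0 < x) (h1 : x < m) :
    ((x : ℝ), (y : ℝ)) ∈ (through x y h0 h1 : LatticePath m e).graph := by
  simpa [through, latticeToR] using
    (through x y h0 h1 : LatticePath m e).vertex_mem_graph (by omega) (1 : Fin 3)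

/-- `P` is above every lattice point that lies below the line `y = θx` and above the chord
of `P`. -/
def DominatesBelow (θ : ℝ) (P : LatticePath m e) : Prop :=
  ∀ x y : ℤ, 0 < x → x < m → y ≤ θ * x → e * x ≤ m * y →
    ∀ z : ℝ, ((x : ℝ), z) ∈ P.graph → y ≤ z

/-- `P` is below every lattice point that lies above the line `y = θx` and below the chord
of `P`. -/
def DominatedAbove (θ : ℝ) (P : LatticePath m e) : Prop :=
  ∀ x y : ℤ, 0 < x → x < m → θ * x ≤ y → m * y ≤ e * x →
    ∀ z : ℝ, ((x : ℝ), z) ∈ P.graph → z ≤ y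

theorem DominatesBelow.reflect {θ : ℝ} {P : LatticePath m e} (h : P.DominatesBelow θ) :
    P.reflect.DominatedAbove (-θ) := by
  intro x y h0 h1 h2 h3 z hz
  have := h x (-y) h0 h1 (by push_cast; linarith) (by linarith) (-z)
    ((P.mem_graph_reflect _ _).1 hz)
  push_cast at this
  linarith

theorem DominatedAbove.reflect {θ : ℝ} {P : LatticePath m e} (h : P.DominatedAbove θ) :
    P.reflect.DominatesBelow (-θ) := by
  intro x y h0 h1 h2 h3 z hz
  have := h x (-y) h0 h1 (by push_cast; linarith) (by linarith) (-z)
    ((P.mem_graph_reflect _ _).1 hz)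
  push_cast at this
  linarith

/-- A path with a single edge contains every point of the chord from `(0,0)` to `(m,e)`. -/
theorem mem_graph_of_n_eq_one (P : LatticePath m e) (hn : P.n = 1) {x z : ℝ} (h0 : 0 ≤ x)
    (h1 : x ≤ m) (hz : z * m = e * x) : (x, z) ∈ P.graph := by
  obtain ⟨n, v, first, last, mono⟩ := P
  obtain rfl : n = 1 := hn
  rw [mem_graph_iff]
  have hl : v 1 = ((m : ℤ), e) := last
  exact ⟨0, by simp [first, hl, hz, h0, h1]⟩

/-- If `P` is the graph of the chord from `(0,0)` to `(m,e)` and contains no further lattice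
point, then no lattice point lies between the line `y = θx` and the chord. -/
theorem lt_of_mul_le_of_card_eq_one {θ : ℝ} (P : LatticePath m e) (hm : 0 < m)
    (hP : P.DominatedAbove θ) (hc : Multiset.card (pathPartition P) ≤ 1)
    (x y : ℤ) (h0 : 0 < x) (h1 : x < m) (h : m * y ≤ e * x) : y < θ * x := by
  by_contra! hy
  have hn := (P.n_le_card_pathPartition hm).trans hc
  have hmR : (0 : ℝ) < m := by exact_mod_cast hm
  have key : ∀ z : ℝ, z * m = e * x → ((x : ℝ), z) ∈ P.graph := by
    intro z hz
    exact P.mem_graph_of_n_eq_one (le_antisymm hn (P.n_pos hm)) (by exact_mod_cast h0.le)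
      (by exact_mod_cast h1.le) hz
  have hz := hP x y h0 h1 hy h (e * x / m) (key _ (by field_simp))
  rw [div_le_iff₀ hmR] at hz
  have hmem : x ∈ latticeXs P.graph := by
    refine ⟨y, key _ (le_antisymm ?_ hz)⟩
    have : (m : ℝ) * y ≤ e * x := by exact_mod_cast h
    linarith
  have := P.card_le_card_pathPartition_add_one {0, x, (m : ℤ)} (by
    simp [hmem, P.zero_mem_latticeXs hm, P.end_mem_latticeXs hm])
  rw [Finset.card_eq_three.2 ⟨0, x, (m : ℤ), by omega, by omega, by omega, rfl⟩] at this
  omega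

theorem three_le_card_pathPartition (P : LatticePath m e) (hm : 0 < m) {x y : ℤ}
    (hx : x ∈ latticeXs P.graph) (hy : y ∈ latticeXs P.graph)
    (h0 : 0 < x) (hxy : x < y) (h1 : y < m) : 3 ≤ Multiset.card (pathPartition P) := by
  have := P.card_le_card_pathPartition_add_one {0, x, y, (m : ℤ)} (by
    simp [hx, hy, P.zero_mem_latticeXs hm, P.end_mem_latticeXs hm])
  have h4 : ({0, x, y, (m : ℤ)} : Finset ℤ).card = 4 := by
    rw [Finset.card_insert_of_notMem, Finset.card_eq_three.2
      ⟨x, y, (m : ℤ), by omega, by omega, by omega, rfl⟩]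
    simp only [Finset.mem_insert, Finset.mem_singleton]
    omega
  omega

/-- The case in which the upper path has a single part. -/
theorem mul_one_sub_fract_lt_two {θ : ℝ} (hθ : Irrational θ) (hm : 0 < m) {e' : ℤ}
    (he : (e : ℝ) ≤ m * θ) (hee : e' = e + 1) (he' : m * θ ≤ e')
    (P : LatticePath m e) (Q : LatticePath m e')
    (hbelow : ∀ i, ((P.v i).2 : ℝ) ≤ θ * (P.v i).1)
    (hP : P.DominatesBelow θ) (hQ : Q.DominatedAbove θ)
    (hcP : Multiset.card (pathPartition P) ≤ 2) (hcQ : Multiset.card (pathPartition Q) ≤ 1) :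
    (m : ℝ) * (1 - Int.fract θ) < 2 := by
  by_contra! hcon
  subst hee
  have hmR : (0 : ℝ) < m := by exact_mod_cast hm
  have hirr : ∀ k : ℤ, (m : ℝ) * θ ≠ k := fun k =>
    (hθ.natCast_mul hm.ne').ne_int k
  have hgap := Q.lt_of_mul_le_of_card_eq_one hm hQ hcQ
  obtain ⟨q, hq⟩ : ∃ q : ℤ, q = ⌊θ⌋ := ⟨_, rfl⟩
  have hqle : (q : ℝ) ≤ θ := hq ▸ Int.floor_le θ
  rw [← Int.self_sub_floor, ← hq] at hcon
  obtain ⟨a, rfl⟩ : ∃ a, e = a + q * m := ⟨e - q * m, by ring⟩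
  push_cast at he he' hgap
  have ha0 : 0 ≤ a := by
    have h1 : (m : ℝ) * q ≤ m * θ := mul_le_mul_of_nonneg_left hqle hmR.le
    have h2 : (m : ℝ) * q ≠ m * θ := fun h => hirr (m * q) (by push_cast; exact h.symm)
    have h4 := lt_of_le_of_ne h1 h2
    have h3 : ((-1 : ℤ) : ℝ) < a := by push_cast; linarith
    have := Int.cast_lt.1 h3
    omega
  have ham : a + 3 ≤ m := by
    have h2 : (m : ℝ) * θ ≠ m * q + m - 2 := fun h =>
      hirr (m * q + m - 2) (by push_cast; exact h)
    have h1 : (m : ℝ) * θ < m * q + m - 2 := lt_of_le_of_ne (by linarith) h2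
    have h3 : ((a + 2 : ℤ) : ℝ) < (m : ℤ) := by push_cast; linarith
    have := Int.cast_lt.1 h3
    omega
  obtain ⟨N, hN⟩ : ∃ N : ℤ, N = m - 1 - a := ⟨_, rfl⟩
  have hmN : (m : ℤ) = N + a + 1 := by omega
  have hN2 : 2 ≤ N := by omega
  obtain ⟨d, hd⟩ : ∃ d, d = a / N := ⟨_, rfl⟩
  have hd0 : 0 ≤ d := hd ▸ Int.ediv_nonneg ha0 (by omega)
  have hd1 : N * d ≤ a := hd ▸ Int.mul_ediv_self_le (by omega)
  have hd2 : a < N * d + N := by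
    have := Int.lt_mul_ediv_self_add (x := a) (k := N) (by omega)
    rwa [← hd] at this
  have hda : d ≤ a := by nlinarith
  obtain ⟨t, ht⟩ : ∃ t, t = a - d + N - 1 := ⟨_, rfl⟩
  have hC := hP (m - 1) (a + q * (m - 1)) (by omega) (by omega)
    (hgap _ _ (by omega) (by omega) (by nlinarith)).le (by nlinarith)
  have hE := hP t (a - d + q * t) (by omega) (by omega)
    (hgap _ _ (by omega) (by omega) (by rw [hmN, ht]; nlinarith)).le
    (by rw [hmN, ht]; nlinarith)
  have hn := (P.n_le_card_pathPartition hm).trans hcP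
  have hn0 := P.n_pos hm
  have hm3 : (3 : ℝ) ≤ m := by exact_mod_cast (by omega : 3 ≤ m)
  obtain h | h : P.n = 1 ∨ P.n = 2 := by omega
  · have key : ∀ x : ℤ, 0 < x → x < m → ∀ z : ℝ, z * m = (a + q * m) * x →
        ((x : ℝ), z) ∈ P.graph := by
      intro x h0 h1 z hz
      exact P.mem_graph_of_n_eq_one h (by exact_mod_cast h0.le) (by exact_mod_cast h1.le)
        (by push_cast; exact hz)
    have h1 := hC _ (key _ (by omega) (by omega) ((a + q * m) * (m - 1) / m)
      (by push_cast; field_simp))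
    rw [le_div_iff₀ hmR] at h1
    norm_cast at h1
    have ha : a = 0 := by
      rw [Int.subNatNat_eq_coe] at h1
      push_cast at h1
      nlinarith
    subst ha
    have hmem : ∀ x : ℤ, 0 < x → x < m → x ∈ latticeXs P.graph := fun x h0 h1 =>
      ⟨q * x, key x h0 h1 _ (by push_cast; ring)⟩
    have := P.three_le_card_pathPartition hm (hmem 1 (by omega) (by omega))
      (hmem 2 (by omega) (by omega)) (by omega) (by omega) (by omega)
    omega
  · obtain ⟨s, y, hs0, hsm, hsy, hsX, hleft, hright⟩ : ∃ s y : ℤ, 0 < s ∧ s < m ∧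
        (y : ℝ) ≤ θ * s ∧ s ∈ latticeXs P.graph ∧
        (∀ x z : ℝ, 0 ≤ x → x ≤ s → z * s = y * x → (x, z) ∈ P.graph) ∧
        (∀ x z : ℝ, s ≤ x → x ≤ m →
          (z - y) * (m - s) = (a + q * m - y) * (x - s) → (x, z) ∈ P.graph) := by
      obtain ⟨n, v, first, last, mono⟩ := P
      obtain rfl : n = 2 := h
      have hl : v 2 = ((m : ℤ), a + q * m) := last
      have h01 := mono 0
      have h12 := mono 1
      refine ⟨(v 1).1, (v 1).2, by simpa [first] using h01, ?_, hbelow 1,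
        fst_mem_latticeXs _ hm 1, ?_, ?_⟩
      · have h12' : (v 1).1 < (v 2).1 := h12
        simpa [hl] using h12'
      · intro x z hx0 hx1 hz
        rw [mem_graph_iff]
        exact ⟨0, by simp [first, hx0, hx1, hz]⟩
      · intro x z hx0 hx1 hz
        rw [mem_graph_iff]
        refine ⟨1, ?_⟩
        change ((v 1).1 : ℝ) ≤ x ∧ x ≤ (v 2).1 ∧ (z - (v 1).2) * ((v 2).1 - (v 1).1) =
          ((v 2).2 - (v 1).2) * (x - (v 1).1)
        simp [hl, hx0, hx1, hz]
    obtain ⟨b, rfl⟩ : ∃ b, y = b + q * s := ⟨y - q * s, by ring⟩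
    have hsR : (0 : ℝ) < s := by exact_mod_cast hs0
    have hsmR : (0 : ℝ) < m - s := sub_pos.2 (by exact_mod_cast hsm)
    have hs1R : (s : ℝ) ≤ m - 1 := by exact_mod_cast (by omega : s ≤ (m : ℤ) - 1)
    push_cast at hsy hleft hright hC hE
    have hba : b ≤ a := by
      have h1 : (θ - q) * s ≤ (θ - q) * m :=
        mul_le_mul_of_nonneg_left (by linarith) (by linarith)
      have h2 : (m : ℝ) * θ ≠ a + q * m + 1 := fun h =>
        hirr (a + q * m + 1) (by push_cast; exact h)
      have h3 := lt_of_le_of_ne he' h2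
      have h4 : (b : ℝ) < ((a + 1 : ℤ) : ℝ) := by push_cast; linarith
      have := Int.cast_lt.1 h4
      omega
    have hab : a ≤ b := by
      have h1 := hC _ (hright _ (b + q * s + (a + q * m - (b + q * s)) * (m - 1 - s) / (m - s))
        hs1R (by linarith) (by field_simp; ring))
      have h2 : ((a : ℝ) + q * (m - 1) - (b + q * s)) * (m - s) ≤
          (a + q * m - (b + q * s)) * (m - 1 - s) := by
        rw [← le_div_iff₀ hsmR]
        linarith
      have h3 : (a : ℝ) ≤ b := by nlinarith
      exact_mod_cast h3
    obtain rfl : b = a := le_antisymm hba hab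
    have hCX : (m : ℤ) - 1 ∈ latticeXs P.graph := by
      refine ⟨b + q * (m - 1), ?_⟩
      push_cast
      exact hright _ _ hs1R (by linarith) (by ring)
    have hs : s = m - 1 := by
      by_contra hne
      have := P.three_le_card_pathPartition hm hsX hCX hs0 (by omega) (by omega)
      omega
    have hts : t < s := by omega
    have htR : (t : ℝ) ≤ s := by exact_mod_cast hts.le
    have ht0 : (0 : ℝ) ≤ t := by exact_mod_cast (by omega : 0 ≤ t)
    have h1 := hE _ (hleft t ((b + q * s) * t / s) ht0 htR (by field_simp))
    rw [le_div_iff₀ hsR] at h1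
    have h2 : (b - d) * s = b * t := by
      apply le_antisymm
      · have : ((b : ℝ) - d) * s ≤ b * t := by linarith
        exact_mod_cast this
      · rw [hs, hmN, ht]
        nlinarith
    have h2R : ((b : ℝ) - d) * s = b * t := by exact_mod_cast h2
    have htX : t ∈ latticeXs P.graph := by
      refine ⟨b - d + q * t, ?_⟩
      push_cast
      exact hleft _ _ ht0 htR (by linarith)
    have := P.three_le_card_pathPartition hm htX hsX (by omega) hts (by omega)
    omega

end LatticePath

theorem IsMaxPosPath.dominatesBelow {θ : ℝ} {m : ℕ} {P : LatticePath m ⌊(m : ℝ) * θ⌋}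
    (h : IsMaxPosPath θ m P) : P.DominatesBelow θ := by
  intro x y h0 h1 hy hxy z hz
  refine h.2 (LatticePath.through x y h0 h1) ⟨?_, ?_⟩ _ _ _
    (LatticePath.mem_graph_through x y h0 h1) hz
  · intro i hi
    obtain rfl : i = 0 := by simpa [LatticePath.through] using hi
    simp [LatticePath.through]
    linarith
  · rintro ⟨x', y'⟩ hp
    have hx : (0 : ℝ) < x := by exact_mod_cast h0
    have hxm : (0 : ℝ) < m - x := sub_pos.2 (by exact_mod_cast h1)
    have hfl := Int.floor_le ((m : ℝ) * θ)
    rw [LatticePath.mem_graph_iff] at hp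
    obtain ⟨i, h1, h2, h3⟩ := hp
    change Fin 2 at i
    fin_cases i <;> simp [LatticePath.through] at h1 h2 h3 ⊢
    · nlinarith
    · nlinarith

theorem IsMinNegPath.dominatedAbove {θ : ℝ} {m : ℕ} {P : LatticePath m ⌈(m : ℝ) * θ⌉}
    (h : IsMinNegPath θ m P) : P.DominatedAbove θ := by
  intro x y h0 h1 hy hxy z hz
  refine h.2 (LatticePath.through x y h0 h1) ⟨?_, ?_⟩ _ _ _
    hz (LatticePath.mem_graph_through x y h0 h1)
  · intro i hi
    obtain rfl : i = 0 := by simpa [LatticePath.through] using hi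
    simp [LatticePath.through]
    linarith
  · rintro ⟨x', y'⟩ hp
    have hx : (0 : ℝ) < x := by exact_mod_cast h0
    have hxm : (0 : ℝ) < m - x := sub_pos.2 (by exact_mod_cast h1)
    have hfl := Int.le_ceil ((m : ℝ) * θ)
    rw [LatticePath.mem_graph_iff] at hp
    obtain ⟨i, h1, h2, h3⟩ := hp
    change Fin 2 at i
    fin_cases i <;> simp [LatticePath.through] at h1 h2 h3 ⊢
    · nlinarith
    · nlinarith

/-- For irrational `θ` and a positive integer `m`, if
`|p⁺_θ(m)| + |p⁻_θ(m)| ≤ 3` then `m·{θ} < 2` or `m·(1 − {θ}) < 2`. -/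
theorem statement5 (θ : ℝ) (hθ : Irrational θ) (m : ℕ) (hm : 0 < m) :
    ∀ (P : LatticePath m ⌊(m : ℝ) * θ⌋) (Q : LatticePath m ⌈(m : ℝ) * θ⌉),
      IsMaxPosPath θ m P → IsMinNegPath θ m Q →
      Multiset.card (pathPartition P) + Multiset.card (pathPartition Q) ≤ 3 →
      (m : ℝ) * Int.fract θ < 2 ∨ (m : ℝ) * (1 - Int.fract θ) < 2 := by
  intro P Q hP hQ hc
  have hce : ⌈(m : ℝ) * θ⌉ = ⌊(m : ℝ) * θ⌋ + 1 := by
    refine Int.ceil_eq_iff.2 ⟨?_, ?_⟩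
    · push_cast
      rw [add_sub_cancel_right]
      exact lt_of_le_of_ne (Int.floor_le _) ((hθ.natCast_mul hm.ne').ne_int _).symm
    · push_cast
      exact (Int.lt_floor_add_one _).le
  have hP1 := (P.n_pos hm).trans_le (P.n_le_card_pathPartition hm)
  have hQ1 := (Q.n_pos hm).trans_le (Q.n_le_card_pathPartition hm)
  have hfl := Int.floor_le ((m : ℝ) * θ)
  have hcl := Int.le_ceil ((m : ℝ) * θ)
  obtain h | h : Multiset.card (pathPartition Q) ≤ 1 ∨ Multiset.card (pathPartition P) ≤ 1 := by
    omega
  · right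
    exact LatticePath.mul_one_sub_fract_lt_two hθ hm hfl hce hcl P Q
      (fun i => hP.1.2 _ (P.vertex_mem_graph hm i)) hP.dominatesBelow hQ.dominatedAbove
      (by omega) h
  · left
    have key := LatticePath.mul_one_sub_fract_lt_two hθ.neg hm
      (by push_cast; linarith) (by omega) (by push_cast; linarith) Q.reflect P.reflect
      (fun i => by
        have := hQ.1.2 _ (Q.vertex_mem_graph hm i)
        simp only [latticeToR] at this
        simp only [LatticePath.reflect, Int.cast_neg]
        linarith)
      hQ.dominatedAbove.reflect hP.dominatesBelow.reflect
      (by rw [LatticePath.pathPartition_reflect]; omega)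
      (by rwa [LatticePath.pathPartition_reflect])
    have hfr : Int.fract θ ≠ 0 := fun h0 => by
      obtain ⟨k, hk⟩ := Int.fract_eq_zero_iff.1 h0
      exact hθ.ne_int k hk.symm
    rw [Int.fract_neg hfr] at key
    linarith
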